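/- If there exists a (v,m,k,λ)-SEDF with k > 1 and m > 2 in a cyclic group of prime order v, then a contradiction follows; i.e., no (v,m,k,λ)-SEDF with v prime, k > 1, m > 2 exists. -/

import Mathlib

/-- A `(v,m,k,λ)`-strong external difference family in a finite abelian group `G`:
`m` pairwise disjoint `k`-subsets `D j` of `G`, `|G| = v`, such that for each `j`,
every non-identity `g ∈ G` has exactly `λ` representations `g = x * y⁻¹` with
`x ∈ D j`, `y ∈ D ℓ`, `ℓ ≠ j`, and the identity has no such representations. -/
def IsSEDF (G : Type) [CommGroup G] [Fintype G] [DecidableEq G]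
    (v m k lam : ℕ) (D : Fin m → Finset G) : Prop :=
  Fintype.card G = v ∧
  (∀ j, (D j).card = k) ∧
  (∀ i j : Fin m, i ≠ j → Disjoint (D i) (D j)) ∧
  ∀ (j : Fin m) (g : G),
    (Finset.univ.filter (fun p : Fin m × G × G =>
      p.1 ≠ j ∧ p.2.1 ∈ D j ∧ p.2.2 ∈ D p.1 ∧ p.2.1 * p.2.2⁻¹ = g)).card
      = if g = 1 then 0 else lam

open Finset ComplexConjugate

/-- On a group of prime order, a nontrivial character has nonzero sum over every subset other than
the empty set and the whole group. -/
theorem eq_empty_or_eq_univ_of_sum_char_eq_zero {G : Type*} [CommGroup G] [Fintype G]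
    (hG : (Fintype.card G).Prime) {χ : G →* ℂ} (hχ : χ ≠ 1) {E : Finset G}
    (hE : ∑ x ∈ E, χ x = 0) : E = ∅ ∨ E = univ := by
  classical
  obtain ⟨g, hg⟩ : ∃ g, χ g ≠ 1 := by
    by_contra! hc
    exact hχ (MonoidHom.ext hc)
  have : Fact (Fintype.card G).Prime := ⟨hG⟩
  have hζ : IsPrimitiveRoot (χ g) (Fintype.card G) := by
    have hpow : χ g ^ Fintype.card G = 1 := by rw [← map_pow, pow_card_eq_one, map_one]
    rw [← orderOf_eq_prime hpow hg]
    exact IsPrimitiveRoot.orderOf _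
  have hinj : Function.Injective fun i : Fin (Fintype.card G) ↦ g ^ (i : ℕ) := by
    intro i j hij
    refine Fin.ext (hζ.pow_inj i.2 j.2 ?_)
    rw [← map_pow, ← map_pow]
    exact congrArg χ hij
  have hbij : Function.Bijective fun i : Fin (Fintype.card G) ↦ g ^ (i : ℕ) :=
    (Fintype.bijective_iff_injective_and_card _).2 ⟨hinj, by simp⟩
  have hsum : ∑ i : Fin (Fintype.card G),
      ((if g ^ (i : ℕ) ∈ E then 1 else 0 : ℤ) : ℂ) * χ g ^ (i : ℕ) = 0 := by
    simp_rw [← map_pow]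
    rw [hbij.sum_comp (fun x ↦ ((if x ∈ E then 1 else 0 : ℤ) : ℂ) * χ x), ← hE]
    simp
  rw [hζ.sum_eq_zero_iff_forall_eq_int hG] at hsum
  rw [or_iff_not_imp_left, ← ne_eq, ← nonempty_iff_ne_empty]
  rintro ⟨x, hx⟩
  refine eq_univ_of_forall fun y ↦ ?_
  obtain ⟨i, rfl⟩ := hbij.2 x
  obtain ⟨j, rfl⟩ := hbij.2 y
  by_contra hy
  simpa [hx, hy] using hsum i j

/-- If every `a j` satisfies `a j * conj (s - a j) = -L`, where `s ≠ 0` is the sum of all the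
`a j` and `0 ≤ L`, then the `a j` take two distinct values, which add up to `s`. -/
theorem exists_ne_add_eq_sum {ι : Type*} [Fintype ι] (hι : 1 < Fintype.card ι) {a : ι → ℂ}
    {L : ℝ} (hL : 0 ≤ L) (hs : ∑ i, a i ≠ 0)
    (ha : ∀ j, a j * conj (∑ i, a i - a j) = -L) :
    ∃ r t, r ≠ t ∧ a r + a t = ∑ i, a i := by
  set s := ∑ i, a i with hs_def
  have hs' : conj s ≠ 0 := by simpa using hs
  have hreal (j : ι) : conj (a j) * s = a j * conj s := by
    have h1 := ha j
    have h2 := congrArg conj h1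
    simp only [map_mul, map_sub, Complex.conj_conj, map_neg, Complex.conj_ofReal] at h1 h2
    linear_combination h2 - h1
  obtain ⟨r, t, hrt⟩ : ∃ r t, a r ≠ a t := by
    by_contra! hc
    obtain ⟨j⟩ : Nonempty ι := Fintype.card_pos_iff.1 (by lia)
    have hsj : s = Fintype.card ι * a j := by
      rw [hs_def, sum_congr rfl fun i _ ↦ hc i j]
      simp
    have haj : a j ≠ 0 := by
      intro h0
      exact hs (by rw [hsj, h0, mul_zero])
    have h1 : ((Complex.normSq (a j) * (Fintype.card ι - 1) : ℝ) : ℂ) = ((-L : ℝ) : ℂ) := by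
      have := ha j
      rw [hsj] at this
      push_cast
      rw [← this, ← Complex.mul_conj]
      simp only [map_sub, map_mul, map_natCast]
      ring
    have h2 := Complex.ofReal_injective h1
    have h3 : (1 : ℝ) < Fintype.card ι := by exact_mod_cast hι
    have h4 := mul_pos (Complex.normSq_pos.2 haj) (sub_pos.2 h3)
    linarith
  refine ⟨r, t, fun h ↦ hrt (h ▸ rfl), ?_⟩
  apply mul_left_cancel₀ (mul_ne_zero hs' (sub_ne_zero.2 hrt))
  have hr := ha r
  have ht := ha t
  simp only [map_sub] at hr ht
  linear_combination (ht - hr) * s - a r * hreal r + a t * hreal t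

theorem conj_char_eq_char_inv {G : Type*} [CommGroup G] [Finite G] (χ : G →* ℂ) (x : G) :
    conj (χ x) = χ x⁻¹ := by
  have hn : ‖χ x‖ = 1 := (χ.isOfFinOrder (isOfFinOrder_of_finite x)).norm_eq_one
  have h0 : χ x ≠ 0 := by
    rw [← norm_ne_zero_iff, hn]
    exact one_ne_zero
  apply mul_left_cancel₀ h0
  rw [Complex.mul_conj, Complex.normSq_eq_norm_sq, hn, ← map_mul, mul_inv_cancel, map_one]
  simp

/-- The group ring equation of a strong external difference family, evaluated at a nontrivial
character. -/
theorem IsSEDF.char_sum_mul_conj {G : Type} [CommGroup G] [Fintype G] [DecidableEq G]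
    {v m k lam : ℕ} {D : Fin m → Finset G} (h : IsSEDF G v m k lam D) {χ : G →* ℂ} (hχ : χ ≠ 1)
    (j : Fin m) :
    (∑ x ∈ D j, χ x) * conj (∑ i, ∑ x ∈ D i, χ x - ∑ x ∈ D j, χ x) = -((lam : ℝ) : ℂ) := by
  set F := univ.filter fun p : Fin m × G × G ↦ p.1 ≠ j ∧ p.2.1 ∈ D j ∧ p.2.2 ∈ D p.1 with hF
  have hcount : ∑ p ∈ F, χ (p.2.1 * p.2.2⁻¹) = -((lam : ℝ) : ℂ) := by
    rw [← sum_fiberwise F (fun p ↦ p.2.1 * p.2.2⁻¹)]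
    have hfib (g : G) : ∑ p ∈ F with p.2.1 * p.2.2⁻¹ = g, χ (p.2.1 * p.2.2⁻¹) =
        lam * χ g - if g = 1 then (lam : ℂ) else 0 := by
      rw [sum_congr rfl (g := fun _ ↦ χ g) fun p hp ↦ by rw [(mem_filter.1 hp).2], sum_const,
        hF, filter_filter]
      simp only [and_assoc]
      rw [h.2.2.2 j g]
      split_ifs with hg <;> simp [hg]
    rw [sum_congr rfl fun g _ ↦ hfib g, sum_sub_distrib, ← mul_sum, sum_hom_units_eq_zero χ hχ]
    simp
  have hdiff : ∑ i, ∑ x ∈ D i, χ x - ∑ x ∈ D j, χ x = ∑ i ∈ univ.erase j, ∑ x ∈ D i, χ x := by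
    rw [← add_sum_erase _ _ (mem_univ j), add_sub_cancel_left]
  rw [← hcount, hdiff, map_sum, mul_sum]
  simp_rw [map_sum, conj_char_eq_char_inv, sum_mul_sum, ← map_mul, hF, sum_filter,
    Fintype.sum_prod_type, ite_and]
  rw [← filter_ne', sum_filter]
  refine sum_congr rfl fun i _ ↦ ?_
  split_ifs <;> simp

theorem stmt_17 (G : Type) [CommGroup G] [Fintype G] [DecidableEq G]
    (v m k lam : ℕ) (hv : v.Prime) (hk : 1 < k) (hm : 2 < m)
    (D : Fin m → Finset G) (h : IsSEDF G v m k lam D) : False := by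
  obtain ⟨rfl, hcard, hdisj, -⟩ := id h
  have : Nontrivial G := Fintype.one_lt_card_iff_nontrivial.1 hv.one_lt
  obtain ⟨g, hg⟩ := exists_ne (1 : G)
  obtain ⟨ψ, hψ⟩ := CommGroup.exists_apply_ne_one_of_hasEnoughRootsOfUnity G ℂ hg
  let χ : G →* ℂ := (Units.coeHom ℂ).comp ψ
  have hχ : χ ≠ 1 := fun h1 ↦ hψ (Units.ext (DFunLike.congr_fun h1 g))
  have hdisj' (S : Finset (Fin m)) : (S : Set (Fin m)).PairwiseDisjoint D :=
    fun i _ j _ hij ↦ hdisj i j hij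
  have hunion (S : Finset (Fin m)) : (S.biUnion D).card = S.card * k := by
    rw [card_biUnion (hdisj' S), sum_congr rfl fun i _ ↦ hcard i, sum_const, smul_eq_mul]
  have hempty (S : Finset (Fin m)) (hS : ∑ i ∈ S, ∑ x ∈ D i, χ x = 0) : S.card = 0 := by
    rw [← sum_biUnion (hdisj' S)] at hS
    have hSk := hunion S
    rcases eq_empty_or_eq_univ_of_sum_char_eq_zero hv hχ hS with h0 | h1
    · rw [h0, card_empty] at hSk
      exact (mul_eq_zero.1 hSk.symm).resolve_right (by lia)
    · rw [h1, card_univ] at hSk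
      rw [hSk] at hv
      rcases Nat.prime_mul_iff.1 hv with ⟨-, h1⟩ | ⟨-, h1⟩
      · lia
      · have hle := card_le_univ (univ.biUnion D)
        rw [hunion, hSk, h1, card_univ, Fintype.card_fin] at hle
        nlinarith
  have hs : ∑ i, ∑ x ∈ D i, χ x ≠ 0 := by
    intro h0
    have := hempty univ h0
    rw [card_univ, Fintype.card_fin] at this
    lia
  obtain ⟨r, t, hrt, hsum⟩ := exists_ne_add_eq_sum (by rw [Fintype.card_fin]; lia)
    (Nat.cast_nonneg lam) hs (h.char_sum_mul_conj hχ)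
  have hcompl : ∑ i ∈ ({r, t} : Finset (Fin m))ᶜ, ∑ x ∈ D i, χ x = 0 := by
    rw [← sum_add_sum_compl {r, t}, sum_pair hrt] at hsum
    simpa using hsum
  have := hempty _ hcompl
  rw [card_compl, card_pair hrt, Fintype.card_fin] at this
  lia
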